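/- Let A be a real symmetric square matrix with all diagonal entries equal to 1 and all off-diagonal entries nonpositive. Then the smallest eigenvalue μ of A satisfies μ = min{vᵗAv : ‖v‖ = 1 and all entries of v are nonnegative}; in particular, the minimum of the Rayleigh quotient of A over unit vectors is attained at a unit vector with nonnegative entries. -/

import Mathlib

open scoped Matrix

/-- The smallest eigenvalue of a real symmetric matrix bounds its quadratic form from below. -/
theorem Matrix.IsHermitian.iInf_eigenvalues_mul_dotProduct_le {ι : Type*} [Fintype ι]
    [DecidableEq ι] {A : Matrix ι ι ℝ} (hA : A.IsHermitian) (w : ι → ℝ) :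
    (⨅ i, hA.eigenvalues i) * (w ⬝ᵥ w) ≤ w ⬝ᵥ A.mulVec w := by
  set μ := ⨅ i, hA.eigenvalues i with hμ
  have hB : (A - algebraMap ℝ (Matrix ι ι ℝ) μ).IsHermitian := by
    refine hA.sub ?_
    rw [Matrix.algebraMap_eq_diagonal]
    exact Matrix.isHermitian_diagonal _
  have hpos : (A - algebraMap ℝ (Matrix ι ι ℝ) μ).PosSemidef := by
    rw [hB.posSemidef_iff_eigenvalues_nonneg]
    intro i
    have h := hB.eigenvalues_mem_spectrum_real i
    rw [← spectrum.sub_singleton_eq, hA.spectrum_real_eq_range_eigenvalues] at h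
    obtain ⟨_, ⟨j, rfl⟩, _, rfl, h⟩ := h
    have hj : μ ≤ hA.eigenvalues j := ciInf_le (Set.finite_range _).bddBelow j
    simp only [Pi.zero_apply, ← h]
    exact sub_nonneg.mpr hj
  have h := hpos.dotProduct_mulVec_nonneg w
  rw [star_trivial, Matrix.sub_mulVec, dotProduct_sub, Algebra.algebraMap_eq_smul_one,
    Matrix.smul_mulVec, Matrix.one_mulVec, dotProduct_smul, smul_eq_mul] at h
  linarith

/-- Taking absolute values entrywise does not increase the quadratic form of a real matrix with
nonpositive off-diagonal entries. -/
theorem Matrix.abs_dotProduct_mulVec_abs_le {ι : Type*} [Fintype ι] {A : Matrix ι ι ℝ}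
    (ho : ∀ i j, i ≠ j → A i j ≤ 0) (v : ι → ℝ) :
    |v| ⬝ᵥ A.mulVec |v| ≤ v ⬝ᵥ A.mulVec v := by
  simp only [dotProduct, Matrix.mulVec, Finset.mul_sum, Pi.abs_apply]
  refine Finset.sum_le_sum fun i _ => Finset.sum_le_sum fun j _ => ?_
  rcases eq_or_ne i j with rfl | hij
  · exact le_of_eq (by linear_combination A i i * abs_mul_abs_self (v i))
  · have h : v i * v j ≤ |v i| * |v j| := abs_mul (v i) (v j) ▸ le_abs_self _
    nlinarith [mul_le_mul_of_nonpos_left h (ho i j hij)]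

/-- For a real symmetric matrix `A` with `1`'s on the diagonal and nonpositive off-diagonal
entries, the smallest eigenvalue `μ` of `A` equals `min{vᵗAv : ‖v‖ = 1, v ≥ 0}`: the
minimum of the Rayleigh quotient over unit vectors is attained at a unit vector with
nonnegative entries. -/
theorem smallest_eigenvalue_attained_nonneg {n : ℕ} (A : Matrix (Fin (n + 1)) (Fin (n + 1)) ℝ)
    (hA : A.IsHermitian) (hd : ∀ i, A i i = 1) (ho : ∀ i j, i ≠ j → A i j ≤ 0) :
    ∃ v : Fin (n + 1) → ℝ, (∀ i, 0 ≤ v i) ∧ (∑ i, v i ^ 2 = 1) ∧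
      v ⬝ᵥ A.mulVec v = (⨅ i, hA.eigenvalues i) ∧
      ∀ w : Fin (n + 1) → ℝ, (∑ i, w i ^ 2 = 1) →
        (⨅ i, hA.eigenvalues i) ≤ w ⬝ᵥ A.mulVec w := by
  have sum_sq (w : Fin (n + 1) → ℝ) : ∑ i, w i ^ 2 = w ⬝ᵥ w := by
    simp only [dotProduct, sq]
  have lower (w : Fin (n + 1) → ℝ) (hw : ∑ i, w i ^ 2 = 1) :
      (⨅ i, hA.eigenvalues i) ≤ w ⬝ᵥ A.mulVec w := by
    simpa [← sum_sq, hw] using hA.iInf_eigenvalues_mul_dotProduct_le w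
  obtain ⟨k, hk⟩ := exists_eq_ciInf_of_finite (f := hA.eigenvalues)
  set v : Fin (n + 1) → ℝ := ⇑(hA.eigenvectorBasis k) with hv
  have hv1 : ∑ i, v i ^ 2 = 1 := by
    have h := EuclideanSpace.real_norm_sq_eq (hA.eigenvectorBasis k)
    rw [hA.eigenvectorBasis.orthonormal.1 k, one_pow] at h
    exact h.symm
  have habs : ∑ i, |v| i ^ 2 = 1 := by simpa using hv1
  refine ⟨|v|, fun i => abs_nonneg (v i), habs, le_antisymm ?_ (lower _ habs), lower⟩
  calc |v| ⬝ᵥ A.mulVec |v| ≤ v ⬝ᵥ A.mulVec v := Matrix.abs_dotProduct_mulVec_abs_le ho v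
    _ = ⨅ i, hA.eigenvalues i := by
      rw [hA.mulVec_eigenvectorBasis, dotProduct_smul, ← sum_sq, hv1, smul_eq_mul, mul_one, hk]
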